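/- Fix t_i > 0, p > 0, σ² > 0, β_j ∈ (0,1), β_i = 1 − β_j, and a constant κ ∈ ℝ. The objective of the beam-gain allocation problem (P8), viewed as a function of the beam gain, G(c) = t_i·log₂(1 + β_i·p·c/(β_j·p·c + σ²)) + min{ κ, t_i·log₂(1 + β_j·p·c/σ²) }, is concave in c on [0,∞); hence (P8), which maximizes this objective (divided by a constant energy) subject to affine constraints, is a convex optimization problem. -/

import Mathlib

/-- The logarithm of a positive concave function is concave. -/
theorem ConcaveOn.logb_of_pos {s : Set ℝ} {f : ℝ → ℝ} {b : ℝ} (hb : 1 < b)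
    (hf : ConcaveOn ℝ s f) (hpos : ∀ x ∈ s, 0 < f x) :
    ConcaveOn ℝ s fun x => Real.logb b (f x) := by
  have hlog : ConcaveOn ℝ s fun x => Real.log (f x) := by
    refine ⟨hf.1, fun x hx y hy u v hu hv huv => ?_⟩
    have hmem : u • f x + v • f y ∈ Set.Ioi (0 : ℝ) :=
      convex_Ioi (0 : ℝ) (hpos x hx) (hpos y hy) hu hv huv
    exact (strictConcaveOn_log_Ioi.concaveOn.2 (hpos x hx) (hpos y hy) hu hv huv).trans
      (Real.log_le_log hmem (hf.2 hx hy hu hv huv))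
  have h := hlog.smul (inv_nonneg.2 (Real.log_pos hb).le)
  simpa [Real.logb, div_eq_inv_mul] using h

/-- The saturating function `c ↦ a c / (b c + s)` is concave on `[0, ∞)`. -/
theorem concaveOn_mul_div_mul_add {a b s : ℝ} (ha : 0 ≤ a) (hb : 0 ≤ b) (hs : 0 < s) :
    ConcaveOn ℝ (Set.Ici (0 : ℝ)) fun c => a * c / (b * c + s) := by
  refine ⟨convex_Ici 0, fun x hx y hy u v hu hv huv => ?_⟩
  simp only [Set.mem_Ici] at hx hy
  simp only [smul_eq_mul]
  set z := u * x + v * y with hz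
  have hz0 : 0 ≤ z := by positivity
  have hdz : 0 < b * z + s := by positivity
  have tangent : ∀ w, 0 ≤ w →
      a * w / (b * w + s) ≤ a * z / (b * z + s) + a * s * (w - z) / (b * z + s) ^ 2 := by
    intro w hw
    have hdw : 0 < b * w + s := by positivity
    have key : a * z / (b * z + s) + a * s * (w - z) / (b * z + s) ^ 2 - a * w / (b * w + s)
        = a * b * s * (w - z) ^ 2 / ((b * z + s) ^ 2 * (b * w + s)) := by
      field_simp
      ring
    have : 0 ≤ a * b * s * (w - z) ^ 2 / ((b * z + s) ^ 2 * (b * w + s)) := by positivity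
    linarith
  calc u * (a * x / (b * x + s)) + v * (a * y / (b * y + s))
      ≤ u * (a * z / (b * z + s) + a * s * (x - z) / (b * z + s) ^ 2) +
          v * (a * z / (b * z + s) + a * s * (y - z) / (b * z + s) ^ 2) := by
        gcongr
        · exact tangent x hx
        · exact tangent y hy
    _ = (u + v) * (a * z / (b * z + s)) +
          a * s * ((u * x + v * y) - (u + v) * z) / (b * z + s) ^ 2 := by ring
    _ = a * z / (b * z + s) := by rw [huv, ← hz]; ring


/-- The objective of the beam-gain allocation problem (P8), viewed as a function of
the beam gain `c`,
`G(c) = t_i·log₂(1 + βi·p·c/(βj·p·c + σ²)) + min { κ, t_i·log₂(1 + βj·p·c/σ²) }`,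
is concave on `[0, ∞)`. -/
theorem beam_gain_objective_concave (ti p σ2 βj βi κ : ℝ)
    (hti : 0 < ti) (hp : 0 < p) (hσ : 0 < σ2)
    (hβj : βj ∈ Set.Ioo (0 : ℝ) 1) (hβi : βi = 1 - βj) :
    ConcaveOn ℝ (Set.Ici (0 : ℝ))
      (fun c : ℝ =>
        ti * Real.logb 2 (1 + βi * p * c / (βj * p * c + σ2)) +
          min κ (ti * Real.logb 2 (1 + βj * p * c / σ2))) := by
  obtain ⟨hβ0, hβ1⟩ := hβj
  have hβi0 : 0 < βi := by linarith
  have hshare : ConcaveOn ℝ (Set.Ici (0 : ℝ))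
      fun c => 1 + βi * p * c / (βj * p * c + σ2) :=
    (concaveOn_const 1 (convex_Ici 0)).add
      (concaveOn_mul_div_mul_add (by positivity) (by positivity) hσ)
  have hlink : ConcaveOn ℝ (Set.Ici (0 : ℝ)) fun c => 1 + βj * p * c / σ2 := by
    have h := (concaveOn_const (1 : ℝ) (convex_Ici (0 : ℝ))).add
      (concaveOn_mul_div_mul_add (a := βj * p) (b := 0) (by positivity) le_rfl hσ)
    simpa [Pi.add_def] using h
  have hshare_log := (hshare.logb_of_pos one_lt_two fun c (hc : 0 ≤ c) => by
    positivity).smul hti.le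
  have hlink_log := (hlink.logb_of_pos one_lt_two fun c (hc : 0 ≤ c) => by
    positivity).smul hti.le
  exact hshare_log.add ((concaveOn_const κ (convex_Ici 0)).inf hlink_log)
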